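/- arXiv:1904.02267 — 2 statements merged into one kernel-verified Lean document; each statement's English description precedes it below -/
import Mathlib

section
/- For every positive integer d, each permutation σ in the symmetric group S_d can be expressed as the product of a strictly monotone sequence of transpositions, and this expression is unique: the map sending a strictly monotone sequence (τ_1, …, τ_k) of transpositions (of any length k ≥ 0, the empty sequence having product the identity) to the product τ_1 τ_2 ⋯ τ_k is a bijection from the set of strictly monotone sequences of transpositions in S_d to S_d. -/
open Equiv

namespace FSM

/-- The number of cycles of a permutation (counting fixed points), i.e. the number of
orbits, realised as the cardinality of the quotient of the underlying set by the
`SameCycle` relation. -/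
noncomputable def cycleCount {α : Type*} (σ : Perm α) : ℕ :=
  Nat.card (Quot σ.SameCycle)

/-- The size of the cycle (orbit) of `σ` containing `x`, counting fixed points as
cycles of length `1`. -/
noncomputable def orbitSize {α : Type*} (σ : Perm α) (x : α) : ℕ :=
  Nat.card {y : α // σ.SameCycle x y}

/-- The cycle type of a permutation including parts equal to `1` for the fixed points. -/
noncomputable def fullCycleType {α : Type*} [Fintype α] [DecidableEq α] (σ : Perm α) :
    Multiset ℕ :=
  σ.cycleType + Multiset.replicate (Fintype.card α - σ.support.card) 1

/-- A list of permutations is a strictly monotone sequence of transpositions if each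
entry is a transposition `(aᵢ bᵢ)` with `aᵢ < bᵢ` and the sequence `b₁, b₂, …` is
strictly increasing. -/
def IsStrictlyMonotone {d : ℕ} (l : List (Perm (Fin d))) : Prop :=
  ∃ ab : List (Fin d × Fin d),
    l = ab.map (fun p => Equiv.swap p.1 p.2) ∧
    (∀ p ∈ ab, p.1 < p.2) ∧
    List.Chain' (· < ·) (ab.map Prod.snd)

/-- A list of permutations is a weakly monotone sequence of transpositions if each
entry is a transposition `(aᵢ bᵢ)` with `aᵢ < bᵢ` and the sequence `b₁, b₂, …` is
weakly increasing. -/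
def IsWeaklyMonotone {d : ℕ} (l : List (Perm (Fin d))) : Prop :=
  ∃ ab : List (Fin d × Fin d),
    l = ab.map (fun p => Equiv.swap p.1 p.2) ∧
    (∀ p ∈ ab, p.1 < p.2) ∧
    List.Chain' (· ≤ ·) (ab.map Prod.snd)

/-- The strictly monotone Hurwitz number `H^<_k(λ; μ)`: `1/d!` times the number of
tuples `(ρ_λ, τ₁, …, τ_k, ρ_μ)` with `ρ_λ` of cycle type `λ`, `ρ_μ` of cycle type `μ`,
`τ₁, …, τ_k` a strictly monotone sequence of transpositions and
`ρ_λ τ₁ ⋯ τ_k ρ_μ = id`. -/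
noncomputable def Hstrict (d k : ℕ) (lam mu : Nat.Partition d) : ℚ :=
  (Nat.card {t : Perm (Fin d) × List (Perm (Fin d)) × Perm (Fin d) //
      fullCycleType t.1 = lam.parts ∧ fullCycleType t.2.2 = mu.parts ∧
      t.2.1.length = k ∧ IsStrictlyMonotone t.2.1 ∧
      t.1 * t.2.1.prod * t.2.2 = 1} : ℚ) / (d.factorial : ℚ)

/-- The weakly monotone Hurwitz number `H^≤_k(λ; μ)`. -/
noncomputable def Hweak (d k : ℕ) (lam mu : Nat.Partition d) : ℚ :=
  (Nat.card {t : Perm (Fin d) × List (Perm (Fin d)) × Perm (Fin d) //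
      fullCycleType t.1 = lam.parts ∧ fullCycleType t.2.2 = mu.parts ∧
      t.2.1.length = k ∧ IsWeaklyMonotone t.2.1 ∧
      t.1 * t.2.1.prod * t.2.2 = 1} : ℚ) / (d.factorial : ℚ)

/-- `z(λ) = ∏ᵢ λᵢ · ∏ⱼ mⱼ(λ)!`. -/
def zPart {d : ℕ} (lam : Nat.Partition d) : ℕ :=
  lam.parts.prod * ∏ j ∈ lam.parts.toFinset, (lam.parts.count j).factorial

end FSM

namespace FSM

/-- The product of the transpositions attached to a list of pairs. -/
def swapProd {α : Type*} [DecidableEq α] (ab : List (α × α)) : Perm α :=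
  (ab.map fun p => swap p.1 p.2).prod

/-- The pairs `(a, b)` of the list satisfy `a < b`, and their second entries strictly increase. -/
def IsMonotonePairs {α : Type*} [LinearOrder α] (ab : List (α × α)) : Prop :=
  (∀ p ∈ ab, p.1 < p.2) ∧ ab.Pairwise fun p q => p.2 < q.2

section LinearOrder

variable {α : Type*} [LinearOrder α]

theorem swapProd_concat (l : List (α × α)) (p : α × α) :
    swapProd (l ++ [p]) = swapProd l * swap p.1 p.2 := by
  simp [swapProd]

theorem isMonotonePairs_concat {l : List (α × α)} {p : α × α} :
    IsMonotonePairs (l ++ [p]) ↔ IsMonotonePairs l ∧ p.1 < p.2 ∧ ∀ q ∈ l, q.2 < p.2 := by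
  simp only [IsMonotonePairs, List.pairwise_append, List.mem_append, List.mem_singleton,
    List.pairwise_singleton]
  grind

theorem swapProd_apply_of_lt {l : List (α × α)} {x : α} (h : ∀ p ∈ l, p.1 < p.2)
    (hx : ∀ p ∈ l, p.2 < x) : swapProd l x = x := by
  induction l with
  | nil => simp [swapProd]
  | cons p l ih =>
    simp only [List.forall_mem_cons] at h hx
    have hl : swapProd (p :: l) = swap p.1 p.2 * swapProd l := by simp [swapProd]
    rw [hl, Perm.mul_apply, ih h.2 hx.2,
      swap_apply_of_ne_of_ne (h.1.trans hx.1).ne' hx.1.ne']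

theorem swapProd_concat_apply_fst {l : List (α × α)} {p : α × α}
    (h : IsMonotonePairs (l ++ [p])) : swapProd (l ++ [p]) p.1 = p.2 := by
  rw [isMonotonePairs_concat] at h
  rw [swapProd_concat, Perm.mul_apply, swap_apply_left, swapProd_apply_of_lt h.1.1 h.2.2]

theorem swapProd_concat_apply_of_lt {l : List (α × α)} {p : α × α}
    (h : IsMonotonePairs (l ++ [p])) {x : α} (hx : p.2 < x) : swapProd (l ++ [p]) x = x := by
  refine swapProd_apply_of_lt h.1 fun q hq => ?_
  rw [isMonotonePairs_concat] at h
  rcases List.mem_append.1 hq with hq | hq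
  · exact (h.2.2 q hq).trans hx
  · rwa [List.mem_singleton.1 hq]

theorem snd_le_of_swapProd_concat_eq {l m : List (α × α)} {p q : α × α}
    (hl : IsMonotonePairs (l ++ [p])) (hm : IsMonotonePairs (m ++ [q]))
    (h : swapProd (l ++ [p]) = swapProd (m ++ [q])) : p.2 ≤ q.2 := by
  by_contra! hlt
  refine (hl.1 p (by simp)).ne ((swapProd (l ++ [p])).injective ?_)
  rw [swapProd_concat_apply_fst hl, h, swapProd_concat_apply_of_lt hm hlt]

theorem swapProd_concat_ne_one {l : List (α × α)} {p : α × α}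
    (h : IsMonotonePairs (l ++ [p])) : swapProd (l ++ [p]) ≠ 1 := fun h1 =>
  (h.1 p (by simp)).ne (by simpa [h1] using swapProd_concat_apply_fst h)

theorem swapProd_injOn : Set.InjOn swapProd {ab : List (α × α) | IsMonotonePairs ab} := by
  intro l hl
  induction l using List.reverseRecOn with
  | nil =>
    intro m hm h
    rcases List.eq_nil_or_concat' m with rfl | ⟨m, q, rfl⟩
    · rfl
    · exact absurd h.symm (swapProd_concat_ne_one hm)
  | append_singleton l p ih =>
    intro m hm h
    rcases List.eq_nil_or_concat' m with rfl | ⟨m, q, rfl⟩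
    · exact absurd h (swapProd_concat_ne_one hl)
    · have h2 : p.2 = q.2 := (snd_le_of_swapProd_concat_eq hl hm h).antisymm
        (snd_le_of_swapProd_concat_eq hm hl h.symm)
      have h1 : p.1 = q.1 := (swapProd (l ++ [p])).injective <| by
        rw [swapProd_concat_apply_fst hl, h, swapProd_concat_apply_fst hm, h2]
      obtain rfl : p = q := Prod.ext h1 h2
      rw [swapProd_concat, swapProd_concat, mul_left_inj] at h
      rw [ih (isMonotonePairs_concat.1 hl).1 (isMonotonePairs_concat.1 hm).1 h]

theorem exists_isMonotonePairs_swapProd_eq [Fintype α] (σ : Perm α) :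
    ∃ ab : List (α × α), IsMonotonePairs ab ∧ (∀ p ∈ ab, p.2 ∈ σ.support) ∧ swapProd ab = σ := by
  induction hn : σ.support.card using Nat.strong_induction_on generalizing σ with
  | _ n ih =>
  by_cases hσ : σ = 1
  · exact ⟨[], by simp [IsMonotonePairs], by simp, by simp [swapProd, hσ]⟩
  have hne : σ.support.Nonempty := by
    rwa [Finset.nonempty_iff_ne_empty, Ne, Perm.support_eq_empty_iff]
  obtain ⟨b, hb, hmax⟩ := σ.support.exists_max_image id hne
  obtain ⟨a, rfl⟩ := σ.surjective b
  have ha : a ∈ σ.support := Perm.apply_mem_support.1 hb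
  have hlt : a < σ a := (hmax a ha).lt_of_ne (Perm.mem_support.1 ha).symm
  have hsub : (σ * swap a (σ a)).support ⊆ σ.support.erase (σ a) := by
    intro x hx
    rw [Perm.mem_support, Perm.mul_apply] at hx
    rw [Finset.mem_erase]
    have hxb : x ≠ σ a := by
      rintro rfl
      simp at hx
    refine ⟨hxb, ?_⟩
    by_cases hxa : x = a
    · rwa [hxa]
    · rwa [swap_apply_of_ne_of_ne hxa hxb, ← Perm.mem_support] at hx
  obtain ⟨l, hl, hs, hprod⟩ := ih _
    (hn ▸ (Finset.card_le_card hsub).trans_lt (Finset.card_erase_lt_of_mem hb)) _ rfl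
  have hs' : ∀ p ∈ l, p.2 ≠ σ a ∧ p.2 ∈ σ.support := fun p hp =>
    Finset.mem_erase.1 (hsub (hs p hp))
  refine ⟨l ++ [(a, σ a)], isMonotonePairs_concat.2 ⟨hl, hlt, fun q hq =>
    (hmax _ (hs' q hq).2).lt_of_ne (hs' q hq).1⟩, fun p hp => ?_, ?_⟩
  · rcases List.mem_append.1 hp with hp | hp
    · exact (hs' p hp).2
    · rwa [List.mem_singleton.1 hp]
  · rw [swapProd_concat, hprod, mul_assoc, swap_mul_self, mul_one]

end LinearOrder

theorem isStrictlyMonotone_iff {d : ℕ} {l : List (Perm (Fin d))} :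
    IsStrictlyMonotone l ↔ ∃ ab : List (Fin d × Fin d),
      l = ab.map (fun p => swap p.1 p.2) ∧ IsMonotonePairs ab :=
  exists_congr fun _ => and_congr_right fun _ => and_congr_right fun _ =>
    List.isChain_iff_pairwise.trans List.pairwise_map

end FSM

open FSM in
/-- **Unique strictly monotone factorisation.**  For a positive integer `d`, the map
sending a strictly monotone sequence `(τ₁, …, τ_k)` of transpositions in `S_d` (of any
length `k ≥ 0`, the empty sequence having product the identity) to the product
`τ₁ τ₂ ⋯ τ_k` is a bijection onto `S_d`. -/
theorem strictlyMonotone_prod_bijective (d : ℕ) (hd : 0 < d) :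
    Function.Bijective
      (fun l : {l : List (Equiv.Perm (Fin d)) // IsStrictlyMonotone l} => l.1.prod) := by
  constructor
  · rintro ⟨l, hl⟩ ⟨m, hm⟩ h
    obtain ⟨ab, rfl, hab⟩ := isStrictlyMonotone_iff.1 hl
    obtain ⟨cd, rfl, hcd⟩ := isStrictlyMonotone_iff.1 hm
    obtain rfl : ab = cd := swapProd_injOn hab hcd h
    rfl
  · intro σ
    obtain ⟨ab, hab, -, hσ⟩ := exists_isMonotonePairs_swapProd_eq σ
    exact ⟨⟨_, isStrictlyMonotone_iff.2 ⟨ab, rfl, hab⟩⟩, hσ⟩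
end

section
/- Let d be a positive integer and let τ_1, …, τ_k be a strictly monotone sequence of transpositions in S_d. Then the product τ_1 τ_2 ⋯ τ_k has exactly d − k cycles on {1, …, d}, counting fixed points as cycles. Equivalently, if a permutation σ ∈ S_d has cycle type ν (a partition of d including parts equal to 1 for fixed points), then the unique strictly monotone sequence of transpositions with product σ has length d − ℓ(ν). -/
open Equiv

namespace FSM

/-- An equivalence relation that relates every point to its image under `σ` contains the
relation `σ.SameCycle`. -/
theorem rel_of_sameCycle {α : Type*} {σ : Perm α} (r : Setoid α) (h : ∀ x, r x (σ x))
    {x y : α} (hxy : σ.SameCycle x y) : r x y := by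
  obtain ⟨i, rfl⟩ := hxy
  induction i with
  | zero => exact r.refl x
  | succ n ih =>
    rw [add_comm, zpow_add, zpow_one, Perm.mul_apply]
    exact r.trans ih (h _)
  | pred n ih =>
    refine r.trans ih (r.symm ?_)
    have := h ((σ ^ (-(n : ℤ) - 1)) x)
    rwa [← Perm.mul_apply, ← zpow_one_add, add_sub_cancel] at this

section MulSwap

variable {α : Type*} [DecidableEq α] {σ : Perm α} {a b : α}

/-- Multiplying by `swap a b`, where `σ` fixes `b`, inserts `b` into the cycle of `a`. -/
theorem sameCycle_mul_swap_iff (hb : σ b = b) (hab : a ≠ b) (x y : α) :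
    (σ * swap a b).SameCycle x y ↔
      σ.SameCycle (if x = b then a else x) (if y = b then a else y) := by
  have ha : (σ * swap a b) a = b := by simp [hb]
  constructor
  · refine rel_of_sameCycle ((Perm.SameCycle.setoid σ).comap fun z => if z = b then a else z) ?_
    intro z
    change σ.SameCycle _ _
    have hne : ∀ w, w ≠ b → σ w ≠ b := fun w hw h => hw (σ.injective (h.trans hb.symm))
    by_cases hza : z = a
    · subst hza
      simp [hb, hab, Perm.SameCycle.refl]
    by_cases hzb : z = b
    · subst hzb
      simp [hne a hab, Perm.SameCycle.refl]
    · simp [swap_apply_of_ne_of_ne hza hzb, hzb, hne z hzb, Perm.SameCycle.refl]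
  · intro h
    have hstep : ∀ z, (σ * swap a b).SameCycle z (σ z) := by
      intro z
      by_cases hza : z = a
      · subst hza
        refine ⟨2, ?_⟩
        rw [zpow_two, Perm.mul_apply, ha]
        simp
      by_cases hzb : z = b
      · rw [hzb, hb]
      · refine ⟨1, ?_⟩
        simp [swap_apply_of_ne_of_ne hza hzb]
    have hcollapse : ∀ z, (σ * swap a b).SameCycle z (if z = b then a else z) := by
      intro z
      split_ifs with hz
      · exact Perm.SameCycle.symm ⟨1, by rw [zpow_one, ha, hz]⟩
      · exact Perm.SameCycle.refl _ _
    exact (hcollapse x).trans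
      ((rel_of_sameCycle (Perm.SameCycle.setoid _) hstep h).trans (hcollapse y).symm)

theorem cycleCount_mul_swap_add_one [Finite α] (hb : σ b = b) (hab : a ≠ b) :
    cycleCount (σ * swap a b) + 1 = cycleCount σ := by
  have mk_eq (τ : Perm α) (x y : α) :
      Quot.mk τ.SameCycle x = Quot.mk τ.SameCycle y ↔ τ.SameCycle x y :=
    ⟨fun h => Quotient.exact (s := Perm.SameCycle.setoid τ) h, fun h => Quot.sound h⟩
  have fixed : ∀ x, σ.SameCycle b x → x = b := by
    rintro x ⟨i, rfl⟩
    exact Perm.zpow_apply_eq_self_of_apply_eq_self hb i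
  have ne_b : ∀ x, (if x = b then a else x) ≠ b := by
    intro x
    split_ifs with h <;> assumption
  let f : Option (Quot (σ * swap a b).SameCycle) → Quot σ.SameCycle := fun o =>
    o.elim (Quot.mk _ b) (Quot.map (fun x => if x = b then a else x)
      fun x y => (sameCycle_mul_swap_iff hb hab x y).1)
  have hf : Function.Bijective f := by
    constructor
    · rintro (_ | ⟨⟨x⟩⟩) (_ | ⟨⟨y⟩⟩) h
      · rfl
      · exact absurd (fixed _ ((mk_eq σ _ _).1 h)) (ne_b y)
      · exact absurd (fixed _ ((mk_eq σ _ _).1 h.symm)) (ne_b x)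
      · exact congrArg some
          ((mk_eq _ x y).2 ((sameCycle_mul_swap_iff hb hab x y).2 ((mk_eq σ _ _).1 h)))
    · rintro ⟨y⟩
      by_cases hy : y = b
      · exact ⟨none, by rw [hy]; rfl⟩
      · exact ⟨some (Quot.mk _ y), congrArg (Quot.mk _) (if_neg hy)⟩
  rw [cycleCount, cycleCount, ← Nat.card_congr (Equiv.ofBijective f hf), Finite.card_option]

end MulSwap

theorem cycleCount_one {α : Type*} : cycleCount (1 : Perm α) = Nat.card α := by
  refine (Nat.card_congr (Equiv.ofBijective (Quot.mk _) ⟨fun x y h => ?_, Quot.mk_surjective⟩)).symm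
  exact Perm.sameCycle_one.1 (Quotient.exact (s := Perm.SameCycle.setoid 1) h)

theorem prod_map_swap_apply_of_notMem {α : Type*} [DecidableEq α] {b : α} (ab : List (α × α))
    (h : ∀ p ∈ ab, b ≠ p.1 ∧ b ≠ p.2) :
    (ab.map fun p => swap p.1 p.2).prod b = b := by
  induction ab with
  | nil => rfl
  | cons p ab ih =>
    rw [List.map_cons, List.prod_cons, Perm.mul_apply,
      ih fun q hq => h q (List.mem_cons_of_mem _ hq)]
    exact swap_apply_of_ne_of_ne (h p List.mem_cons_self).1 (h p List.mem_cons_self).2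

theorem cycleCount_prod_map_swap_add_length {α : Type*} [LinearOrder α] [Finite α]
    (ab : List (α × α)) (hlt : ∀ p ∈ ab, p.1 < p.2)
    (hmono : (ab.map Prod.snd).Pairwise (· < ·)) :
    cycleCount (ab.map fun p => swap p.1 p.2).prod + ab.length = Nat.card α := by
  induction ab using List.reverseRecOn with
  | nil => simpa using cycleCount_one
  | append_singleton ab p ih =>
    rw [List.map_append, List.pairwise_append] at hmono
    obtain ⟨hmono, -, hlast⟩ := hmono
    have hlt' : ∀ q ∈ ab, q.1 < q.2 := fun q hq => hlt q (List.mem_append_left _ hq)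
    have hfix : (ab.map fun q => swap q.1 q.2).prod p.2 = p.2 := by
      refine prod_map_swap_apply_of_notMem ab fun q hq => ?_
      have hq2 : q.2 < p.2 := hlast _ (List.mem_map_of_mem hq) _ (by simp)
      exact ⟨((hlt' q hq).trans hq2).ne', hq2.ne'⟩
    have hcount := cycleCount_mul_swap_add_one hfix (hlt p (by simp)).ne
    have := ih hlt' hmono
    simp only [List.map_append, List.map_cons, List.map_nil, List.prod_append,
      List.prod_singleton, List.length_append, List.length_singleton]
    omega

end FSM

open FSM in
/-- **Cycle count of a strictly monotone product.**  If `τ₁, …, τ_k` is a strictly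
monotone sequence of transpositions in `S_d`, then the product `τ₁ τ₂ ⋯ τ_k` has
exactly `d - k` cycles on `{1, …, d}`, counting fixed points as cycles. -/
theorem cycleCount_strictlyMonotone_prod (d : ℕ) (hd : 0 < d)
    (l : List (Equiv.Perm (Fin d))) (hl : IsStrictlyMonotone l) :
    cycleCount l.prod = d - l.length := by
  obtain ⟨ab, rfl, hlt, hmono⟩ := hl
  have h := cycleCount_prod_map_swap_add_length ab hlt (List.isChain_iff_pairwise.1 hmono)
  rw [Nat.card_fin] at h
  rw [List.length_map]
  omega
end
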